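/- Let H, J : I₁×I₂×I₃ × [0,1] → I₁×I₂×I₃ be ambient isotopies of the cube such that: H has a product structure in the z direction for z ∈ [1/4,1], meaning H(x,y,z,s) = (X(x,y,s), Y(x,y,s), z) there; J has a product structure in the z direction for z ∈ [0,3/4]; and for each of H and J, for each fixed s the z-coordinate of the image depends only on z and defines a monotone increasing diffeomorphism of [0,1], for each fixed z and s the y-coordinate depends only on y and defines a monotone increasing diffeomorphism of [0,1], and for each fixed y, z, s the x-coordinate defines a monotone increasing diffeomorphism of [0,1] in x. Let φ : [0,1] → [0,1] be a smooth monotone function equal to 0 on [0, 1/4+ε] and to 1 on [3/4−ε, 1] for some ε > 0. Then K(x,y,z,s) = (1−φ(z))H(x,y,z,s) + φ(z)J(x,y,z,s) is an ambient isotopy of the cube, i.e. K(·,s) is a diffeomorphism of I₁×I₂×I₃ for each s ∈ [0,1], and K inherits the same triangular monotonicity structure. -/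

import Mathlib

/-! ## Geometry of tangles and 2-tangles (after Baez–Langford, HDA IV) -/

noncomputable section
open Set

namespace HDA4

abbrev Pt2 := ℝ × ℝ
abbrev Pt3 := ℝ × ℝ × ℝ
abbrev Pt4 := ℝ × ℝ × ℝ × ℝ

/-- The unit interval `[0,1]`. -/
def II : Set ℝ := Icc 0 1
/-- The unit square `I₁ × I₂`. -/
def sq : Set Pt2 := II ×ˢ II
/-- The unit cube `I₁ × I₂ × I₃`. -/
def cube : Set Pt3 := II ×ˢ II ×ˢ II
/-- The unit 4-cube `I₁ × I₂ × I₃ × I₄`. -/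
def cube4 : Set Pt4 := II ×ˢ II ×ˢ II ×ˢ II

def x3 (p : Pt3) : ℝ := p.1
def y3 (p : Pt3) : ℝ := p.2.1
def z3 (p : Pt3) : ℝ := p.2.2
def x4 (p : Pt4) : ℝ := p.1
def y4 (p : Pt4) : ℝ := p.2.1
def z4 (p : Pt4) : ℝ := p.2.2.1
def t4 (p : Pt4) : ℝ := p.2.2.2

/-- A generic finite subset of the square: finite, contained in the interior,
with no two points sharing the same `y` coordinate. -/
structure IsGenericSubset (A : Set Pt2) : Prop where
  finite : A.Finite
  interior : A ⊆ Ioo (0:ℝ) 1 ×ˢ Ioo (0:ℝ) 1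
  injY : InjOn Prod.snd A

/-- An ambient isotopy of the square: a smooth family of diffeomorphisms of `I₁ × I₂`. -/
structure SquareIsotopy (H : Pt2 → ℝ → Pt2) : Prop where
  smooth : ContDiff ℝ (⊤ : ℕ∞) fun q : Pt2 × ℝ => H q.1 q.2
  mapsTo : ∀ s ∈ II, MapsTo (fun p => H p s) sq sq
  diffeo : ∀ s ∈ II, ∃ G : Pt2 → Pt2, ContDiff ℝ (⊤ : ℕ∞) G ∧ InvOn G (fun p => H p s) sq sq

/-- Level preserving: a fiber isotopy for the bundle `I₁ × I₂ → I₂`. -/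
def LevelPreserving2 (H : Pt2 → ℝ → Pt2) : Prop :=
  ∀ s ∈ II, ∀ p q : Pt2, p.2 = q.2 → (H p s).2 = (H q s).2

/-- Equivalence of generic finite subsets of the square. -/
def SubsetEquiv (A B : Set Pt2) : Prop :=
  ∃ H, SquareIsotopy H ∧ LevelPreserving2 H ∧
    (fun p => H p 0) '' A = A ∧ (fun p => H p 1) '' A = B

/-- A smooth regular local parametrization of `T` through `p`. -/
def LocalCurveAt (T : Set Pt3) (p : Pt3) (γ : ℝ → Pt3) (δ : ℝ) : Prop :=
  0 < δ ∧ γ 0 = p ∧ ContDiff ℝ (⊤ : ℕ∞) γ ∧ deriv γ 0 ≠ 0 ∧ ∀ t ∈ Ioo (-δ) δ, γ t ∈ T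

/-- A tangle: a compact 1-manifold with boundary smoothly embedded in
`int(I₁ × I₂) × I₃`, with boundary in `int(I₁ × I₂) × {0,1}` and a product
structure near the top and the bottom. -/
structure IsTangle (T : Set Pt3) : Prop where
  compact : IsCompact T
  subset : T ⊆ Ioo (0:ℝ) 1 ×ˢ Ioo (0:ℝ) 1 ×ˢ II
  manifold : ∀ p ∈ T, ∃ (U : Set Pt3) (γ : ℝ → Pt3) (J : Set ℝ),
    IsOpen U ∧ p ∈ U ∧ ContDiff ℝ (⊤ : ℕ∞) γ ∧ InjOn γ J ∧
    (∀ t ∈ J, deriv γ t ≠ 0) ∧ (J = Ioo (-1:ℝ) 1 ∨ J = Ico (0:ℝ) 1) ∧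
    (0:ℝ) ∈ J ∧ γ 0 = p ∧ T ∩ U = γ '' J
  boundary : ∀ p ∈ T,
    (¬ ∃ (U : Set Pt3) (γ : ℝ → Pt3), IsOpen U ∧ p ∈ U ∧ ContDiff ℝ (⊤ : ℕ∞) γ ∧
        InjOn γ (Ioo (-1:ℝ) 1) ∧ (∀ t ∈ Ioo (-1:ℝ) 1, deriv γ t ≠ 0) ∧
        γ 0 = p ∧ T ∩ U = γ '' Ioo (-1:ℝ) 1) → z3 p = 0 ∨ z3 p = 1
  product : ∃ ε > 0, ∀ x y : ℝ, ∀ z ∈ II, ∀ z' ∈ II,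
    ((z ≤ ε ∧ z' ≤ ε) ∨ (1 - ε ≤ z ∧ 1 - ε ≤ z')) →
    ((x, y, z) ∈ T ↔ (x, y, z') ∈ T)

/-- Projection of the cube onto the square `I₂ × I₃` (the plane of the diagram). -/
def pYZ (p : Pt3) : Pt2 := (p.2.1, p.2.2)

/-- A generic tangle: the projection to `I₂ × I₃` is an embedding except for
finitely many transverse double points (crossings), the critical points of the
height function `z` are nondegenerate local extrema, and all crossings and
critical points occur at distinct heights. -/
def IsGenericTangle (T : Set Pt3) : Prop :=
  IsTangle T ∧
  ∃ (Cr : Finset Pt2) (Ex : Finset Pt3),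
    (Ex : Set Pt3) ⊆ T ∧
    InjOn pYZ (T \ pYZ ⁻¹' (Cr : Set Pt2)) ∧
    (∀ c ∈ Cr, ∃ p q : Pt3, p ≠ q ∧ T ∩ pYZ ⁻¹' {c} = {p, q} ∧
      ∃ (γp γq : ℝ → Pt3) (δ : ℝ), LocalCurveAt T p γp δ ∧ LocalCurveAt T q γq δ ∧
        LinearIndependent ℝ ![pYZ (deriv γp 0), pYZ (deriv γq 0)]) ∧
    (∀ p ∈ T, (p ∈ Ex ↔ ∃ γ δ, LocalCurveAt T p γ δ ∧ deriv (fun t => z3 (γ t)) 0 = 0)) ∧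
    (∀ p ∈ Ex, ∀ γ δ, LocalCurveAt T p γ δ →
      deriv (fun t => z3 (γ t)) 0 = 0 ∧ deriv (deriv fun t => z3 (γ t)) 0 ≠ 0) ∧
    InjOn Prod.snd (Cr : Set Pt2) ∧ InjOn z3 (Ex : Set Pt3) ∧
    ∀ c ∈ Cr, ∀ p ∈ Ex, c.2 ≠ z3 p

/-- An ambient isotopy of the cube. -/
structure CubeIsotopy (H : Pt3 → ℝ → Pt3) : Prop where
  smooth : ContDiff ℝ (⊤ : ℕ∞) fun q : Pt3 × ℝ => H q.1 q.2
  mapsTo : ∀ s ∈ II, MapsTo (fun p => H p s) cube cube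
  diffeo : ∀ s ∈ II, ∃ G : Pt3 → Pt3, ContDiff ℝ (⊤ : ℕ∞) G ∧ InvOn G (fun p => H p s) cube cube

/-- An equivalence isotopy between generic tangles: level preserving for the
bundles `I₁×I₂×I₃ → I₂×I₃` and `I₁×I₂×I₃ → I₃`, with a product structure in a
neighborhood of `I₁ × I₂ × ∂I₃`. -/
structure TangleEquivIsotopy (H : Pt3 → ℝ → Pt3) : Prop where
  isotopy : CubeIsotopy H
  levelYZ : ∀ s ∈ II, ∀ p q : Pt3, pYZ p = pYZ q → pYZ (H p s) = pYZ (H q s)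
  levelZ : ∀ s ∈ II, ∀ p q : Pt3, z3 p = z3 q → z3 (H p s) = z3 (H q s)
  product : ∃ ε > 0, ∀ s ∈ II, ∀ x y : ℝ, ∀ z ∈ II,
    (z ≤ ε → H (x, y, z) s = (x3 (H (x, y, 0) s), y3 (H (x, y, 0) s), z)) ∧
    (1 - ε ≤ z → H (x, y, z) s = (x3 (H (x, y, 1) s), y3 (H (x, y, 1) s), z))

/-- Equivalence of generic tangles. -/
def TangleEquiv (T T' : Set Pt3) : Prop :=
  ∃ H, TangleEquivIsotopy H ∧ (∀ p, H p 0 = p) ∧ (fun p => H p 1) '' T = T'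

/-- The source set of a tangle. -/
def srcSet (T : Set Pt3) : Set Pt2 := {q : Pt2 | (q.1, q.2, (0:ℝ)) ∈ T}
/-- The target set of a tangle. -/
def tgtSet (T : Set Pt3) : Set Pt2 := {q : Pt2 | (q.1, q.2, (1:ℝ)) ∈ T}
/-- Gluing of tangles in the `z` direction:
`(T ∩ I₁×I₂×[0,1/2]) ∪ (T' ∩ I₁×I₂×[1/2,1])`. -/
def glueZ (T T' : Set Pt3) : Set Pt3 := {p ∈ T | z3 p ≤ 1/2} ∪ {p ∈ T' | 1/2 ≤ z3 p}
/-- A tangle has a product structure in the `z` direction on `[a,b]`. -/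
def ProductZOn (T : Set Pt3) (a b : ℝ) : Prop :=
  ∀ x y : ℝ, ∀ z ∈ Icc a b, ∀ z' ∈ Icc a b, ((x, y, z) ∈ T ↔ (x, y, z') ∈ T)
/-- The identity tangle `A × I₃` on a subset of the square. -/
def cylMor (A : Set Pt2) : Set Pt3 := {p : Pt3 | (x3 p, y3 p) ∈ A ∧ z3 p ∈ II}

/-- The slice of a subset of the 4-cube at `t = t₀`. -/
def tSlice (S : Set Pt4) (t : ℝ) : Set Pt3 := {p : Pt3 | (p.1, p.2.1, p.2.2, t) ∈ S}
/-- The source tangle of a 2-tangle. -/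
def srcTangle (S : Set Pt4) : Set Pt3 := tSlice S 0
/-- The target tangle of a 2-tangle. -/
def tgtTangle (S : Set Pt4) : Set Pt3 := tSlice S 1

/-- A 2-tangle: a compact 2-manifold with corners embedded in the 4-cube whose
boundary lies in `I₁×I₂×∂(I₃×I₄)`, meeting `I₁×I₂×I₃×∂I₄` in a pair of tangles
and `I₁×I₂×∂I₃×I₄` in finitely many straight lines, with a product structure
near the boundary. -/
structure IsTwoTangle (S : Set Pt4) : Prop where
  compact : IsCompact S
  subset : S ⊆ cube4
  manifold : ∀ p ∈ S, ∃ (U : Set Pt4) (φ : Pt2 → Pt4) (J : Set Pt2),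
    IsOpen U ∧ p ∈ U ∧ ContDiff ℝ (⊤ : ℕ∞) φ ∧ InjOn φ J ∧
    (J = Ioo (-1:ℝ) 1 ×ˢ Ioo (-1:ℝ) 1 ∨ J = Ioo (-1:ℝ) 1 ×ˢ Ico (0:ℝ) 1 ∨
      J = Ico (0:ℝ) 1 ×ˢ Ico (0:ℝ) 1) ∧
    ((0:ℝ), (0:ℝ)) ∈ J ∧ φ (0, 0) = p ∧ S ∩ U = φ '' J ∧
    ∀ q ∈ J, LinearIndependent ℝ ![fderiv ℝ φ q (1, 0), fderiv ℝ φ q (0, 1)]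
  endTangles : IsTangle (tSlice S 0) ∧ IsTangle (tSlice S 1)
  sides : ∃ L : Finset Pt3, (∀ q ∈ L, z3 q = 0 ∨ z3 q = 1) ∧
    {p ∈ S | z4 p = 0 ∨ z4 p = 1} =
      {p : Pt4 | (x4 p, y4 p, z4 p) ∈ (L : Set Pt3) ∧ t4 p ∈ II}
  productZ : ∃ ε > 0, ∀ x y t : ℝ, ∀ z ∈ II, ∀ z' ∈ II,
    ((z ≤ ε ∧ z' ≤ ε) ∨ (1 - ε ≤ z ∧ 1 - ε ≤ z')) →
    ((x, y, z, t) ∈ S ↔ (x, y, z', t) ∈ S)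
  productT : ∃ ε > 0, ∀ x y z : ℝ, ∀ t ∈ II, ∀ t' ∈ II,
    ((t ≤ ε ∧ t' ≤ ε) ∨ (1 - ε ≤ t ∧ 1 - ε ≤ t')) →
    ((x, y, z, t) ∈ S ↔ (x, y, z, t') ∈ S)

/-- A generic 2-tangle: its constant-`t` slices are generic tangles except for
finitely many values of `t` (at which exactly one of Carter–Rieger–Saito's
elementary string interactions occurs). -/
def IsGenericTwoTangle (S : Set Pt4) : Prop :=
  IsTwoTangle S ∧ ∃ F : Finset ℝ, (F : Set ℝ) ⊆ II ∧
    ∀ t ∈ II \ (F : Set ℝ), IsGenericTangle (tSlice S t)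

def p123 (p : Pt4) : Pt3 := (p.1, p.2.1, p.2.2.1)
def emb3 (p : Pt3) (t : ℝ) : Pt4 := (p.1, p.2.1, p.2.2, t)

/-- An ambient isotopy of the 4-cube. -/
structure CubeIsotopy4 (H : Pt4 → ℝ → Pt4) : Prop where
  smooth : ContDiff ℝ (⊤ : ℕ∞) fun q : Pt4 × ℝ => H q.1 q.2
  mapsTo : ∀ s ∈ II, MapsTo (fun p => H p s) cube4 cube4
  diffeo : ∀ s ∈ II, ∃ G : Pt4 → Pt4, ContDiff ℝ (⊤ : ℕ∞) G ∧ InvOn G (fun p => H p s) cube4 cube4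

/-- An equivalence isotopy between generic 2-tangles (Definition 4 of HDA IV):
restrictions at `t = 0,1` are equivalence isotopies of generic tangles,
restrictions at `z = 0,1` are level preserving, and the whole isotopy has a
product structure near `I₁ × I₂ × ∂(I₃ × I₄)`. -/
structure TwoTangleEquivIsotopy (H : Pt4 → ℝ → Pt4) : Prop where
  isotopy : CubeIsotopy4 H
  productT : ∃ ε > 0, ∀ s ∈ II, ∀ x y z : ℝ, ∀ t ∈ II,
    (t ≤ ε → H (x, y, z, t) s =
      (x4 (H (x, y, z, 0) s), y4 (H (x, y, z, 0) s), z4 (H (x, y, z, 0) s), t)) ∧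
    (1 - ε ≤ t → H (x, y, z, t) s =
      (x4 (H (x, y, z, 1) s), y4 (H (x, y, z, 1) s), z4 (H (x, y, z, 1) s), t))
  productZ : ∃ ε > 0, ∀ s ∈ II, ∀ x y t : ℝ, ∀ z ∈ II,
    (z ≤ ε → H (x, y, z, t) s =
      (x4 (H (x, y, 0, t) s), y4 (H (x, y, 0, t) s), z, t4 (H (x, y, 0, t) s))) ∧
    (1 - ε ≤ z → H (x, y, z, t) s =
      (x4 (H (x, y, 1, t) s), y4 (H (x, y, 1, t) s), z, t4 (H (x, y, 1, t) s)))
  endEquiv : ∀ t₀ : ℝ, t₀ = 0 ∨ t₀ = 1 →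
    TangleEquivIsotopy fun p s => p123 (H (emb3 p t₀) s)
  levelSides : ∀ z₀ : ℝ, z₀ = 0 ∨ z₀ = 1 → ∀ s ∈ II, ∀ p q : Pt4,
    z4 p = z₀ → z4 q = z₀ →
    ((y4 p, t4 p) = (y4 q, t4 q) → (y4 (H p s), t4 (H p s)) = (y4 (H q s), t4 (H q s))) ∧
    (t4 p = t4 q → t4 (H p s) = t4 (H q s))

/-- Equivalence of generic 2-tangles. -/
def TwoTangleEquiv (S S' : Set Pt4) : Prop :=
  ∃ H, TwoTangleEquivIsotopy H ∧ (∀ p, H p 0 = p) ∧ (fun p => H p 1) '' S = S'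

/-- Gluing of 2-tangles in the `t` direction (vertical composition). -/
def glueT (S S' : Set Pt4) : Set Pt4 := {p ∈ S | t4 p ≤ 1/2} ∪ {p ∈ S' | 1/2 ≤ t4 p}
/-- Gluing of 2-tangles in the `z` direction (horizontal composition). -/
def glueZ4 (S S' : Set Pt4) : Set Pt4 := {p ∈ S | z4 p ≤ 1/2} ∪ {p ∈ S' | 1/2 ≤ z4 p}
/-- A 2-tangle has a product structure in the `t` direction on `[a,b]`. -/
def ProductTOn (S : Set Pt4) (a b : ℝ) : Prop :=
  ∀ x y z : ℝ, ∀ t ∈ Icc a b, ∀ t' ∈ Icc a b, ((x, y, z, t) ∈ S ↔ (x, y, z, t') ∈ S)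
/-- A 2-tangle has a product structure in the `z` direction on `[a,b]`. -/
def ProductZOn4 (S : Set Pt4) (a b : ℝ) : Prop :=
  ∀ x y t : ℝ, ∀ z ∈ Icc a b, ∀ z' ∈ Icc a b, ((x, y, z, t) ∈ S ↔ (x, y, z', t) ∈ S)
/-- The identity 2-tangle `T × I₄` on a tangle `T`. -/
def cylCell (T : Set Pt3) : Set Pt4 := {p : Pt4 | (x4 p, y4 p, z4 p) ∈ T ∧ t4 p ∈ II}
/-- The identity 2-tangle `A × I₃ × I₄` on a subset `A` of the square. -/
def cylObj2 (A : Set Pt2) : Set Pt4 := {p : Pt4 | (x4 p, y4 p) ∈ A ∧ z4 p ∈ II ∧ t4 p ∈ II}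

/-- The 2-tangle traced out by an isotopy `H` applied to a tangle `U`:
`{(H(x,y,z,s),s) : (x,y,z) ∈ U}`. -/
def traceSurf (H : Pt3 → ℝ → Pt3) (U : Set Pt3) : Set Pt4 :=
  {q : Pt4 | ∃ p ∈ U, ∃ s ∈ II, q = emb3 (H p s) s}

/-- A 2-tangle which is traced out by an ambient isotopy of the cube applied to
a generic tangle; such a 2-tangle always represents a 2-isomorphism, with
inverse traced out by the reverse isotopy. -/
def IsIsotopyTrace (S : Set Pt4) : Prop :=
  ∃ H U, CubeIsotopy H ∧ (∀ p, H p 0 = p) ∧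
    (∃ ε > 0, ∀ p, (∀ s ∈ Icc (0:ℝ) ε, H p s = H p 0) ∧ ∀ s ∈ Icc (1-ε) 1, H p s = H p 1) ∧
    IsGenericTangle U ∧ S = traceSurf H U

/-- Reflection of the square in the `y` direction (duals of objects). -/
def reflY2 (A : Set Pt2) : Set Pt2 := {p : Pt2 | (p.1, 1 - p.2) ∈ A}
/-- Reflection of the cube in the `z` direction (duals of 1-morphisms). -/
def reflZ3 (T : Set Pt3) : Set Pt3 := {p : Pt3 | (p.1, p.2.1, 1 - p.2.2) ∈ T}
/-- Reflection of the 4-cube in the `t` direction (duals of 2-morphisms). -/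
def reflT4 (S : Set Pt4) : Set Pt4 := {p : Pt4 | (p.1, p.2.1, p.2.2.1, 1 - p.2.2.2) ∈ S}

end HDA4
namespace HDA4

/-- The "triangular" structure of an isotopy of the cube (used in the proof of
Lemma 1 of HDA IV): for each fixed `s` the `z` coordinate of the image depends
only on `z` and defines a monotone increasing diffeomorphism of `[0,1]` (here:
a strictly monotone smooth surjection of `[0,1]` onto itself); for each fixed
`z, s` the `y` coordinate depends only on `y` and is likewise monotone onto;
and for each fixed `y, z, s` the `x` coordinate is monotone in `x` and onto. -/
structure TriangularMonotone (H : Pt3 → ℝ → Pt3) : Prop where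
  zOnly : ∀ s ∈ II, ∀ p q : Pt3, z3 p = z3 q → z3 (H p s) = z3 (H q s)
  zMono : ∀ s ∈ II, ∀ x y : ℝ,
    StrictMonoOn (fun z => z3 (H (x, y, z) s)) II ∧
    (fun z => z3 (H (x, y, z) s)) '' II = II
  yOnly : ∀ s ∈ II, ∀ p q : Pt3, y3 p = y3 q → z3 p = z3 q →
    y3 (H p s) = y3 (H q s)
  yMono : ∀ s ∈ II, ∀ x z : ℝ,
    StrictMonoOn (fun y => y3 (H (x, y, z) s)) II ∧
    (fun y => y3 (H (x, y, z) s)) '' II = II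
  xMono : ∀ s ∈ II, ∀ y z : ℝ,
    StrictMonoOn (fun x => x3 (H (x, y, z) s)) II ∧
    (fun x => x3 (H (x, y, z) s)) '' II = II

/-- The isotopy `H` has a product structure in the `z` direction on `[a,b]`:
there, `H(x,y,z,s) = (X(x,y,s), Y(x,y,s), z)`. -/
def IsotopyProductZOn (H : Pt3 → ℝ → Pt3) (a b : ℝ) : Prop :=
  ∀ s ∈ II, ∀ x y : ℝ, ∀ z ∈ Icc a b, ∀ z' ∈ Icc a b,
    x3 (H (x, y, z) s) = x3 (H (x, y, z') s) ∧
    y3 (H (x, y, z) s) = y3 (H (x, y, z') s) ∧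
    z3 (H (x, y, z) s) = z

/-- On a finite-dimensional space, a smooth map which is injective on a compact set and has
invertible derivative at each of its points has a globally smooth left inverse on that set. -/
theorem exists_contDiff_leftInvOn {E : Type*} [NormedAddCommGroup E] [NormedSpace ℝ E]
    [FiniteDimensional ℝ E] {f : E → E} {C : Set E} (hf : ContDiff ℝ (⊤ : ℕ∞) f)
    (hC : IsCompact C) (hinj : InjOn f C)
    (hder : ∀ p ∈ C, Function.Injective (fderiv ℝ f p)) :
    ∃ G : E → E, ContDiff ℝ (⊤ : ℕ∞) G ∧ LeftInvOn G f C := by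
  have : CompleteSpace E := FiniteDimensional.complete ℝ E
  have hne : ((⊤ : ℕ∞) : WithTop ℕ∞) ≠ 0 := by simp
  have hstrict : ∀ p, HasStrictFDerivAt f (fderiv ℝ f p) p := fun p =>
    hf.contDiffAt.hasStrictFDerivAt hne
  set R : Set E := fderiv ℝ f ⁻¹' range ((↑) : (E ≃L[ℝ] E) → E →L[ℝ] E)
  have hRopen : IsOpen R := ContinuousLinearEquiv.isOpen.preimage (hf.continuous_fderiv hne)
  have hCR : C ⊆ R := fun p hp =>
    ⟨(LinearEquiv.ofInjectiveEndo (fderiv ℝ f p : E →ₗ[ℝ] E) (hder p hp)).toContinuousLinearEquiv,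
      by ext v; rfl⟩
  obtain ⟨t, ht, htinj⟩ := hinj.exists_mem_nhdsSet hC (fun p _ => hf.continuous.continuousAt)
    (fun p hp => by
      obtain ⟨e, he⟩ := hCR hp
      have hs : HasStrictFDerivAt f (e : E →L[ℝ] E) p := he ▸ hstrict p
      exact ⟨_, (hs.toOpenPartialHomeomorph f).open_source.mem_nhds
        hs.mem_toOpenPartialHomeomorph_source, (hs.toOpenPartialHomeomorph f).injOn⟩)
  obtain ⟨W, hWopen, hCW, hWt⟩ := mem_nhdsSet_iff_exists.1 ht
  set U : Set E := W ∩ R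
  have hUopen : IsOpen U := hWopen.inter hRopen
  have hUinj : InjOn f U := htinj.mono (inter_subset_left.trans hWt)
  have hCU : C ⊆ U := subset_inter hCW hCR
  set g : E → E := Function.invFunOn f U
  have hg : LeftInvOn g f U := hUinj.leftInvOn_invFunOn
  have hVopen : IsOpen (f '' U) := by
    rw [isOpen_iff_mem_nhds]
    rintro _ ⟨p, hp, rfl⟩
    obtain ⟨e, he⟩ := hp.2
    have hs : HasStrictFDerivAt f (e : E →L[ℝ] E) p := he ▸ hstrict p
    rw [← hs.map_nhds_eq_of_equiv]
    exact Filter.image_mem_map (hUopen.mem_nhds hp)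
  have hgsmooth : ∀ q ∈ f '' U, ContDiffAt ℝ (⊤ : ℕ∞) g q := by
    rintro _ ⟨p, hp, rfl⟩
    obtain ⟨e, he⟩ := hp.2
    have hs : HasStrictFDerivAt f (e : E →L[ℝ] E) p := he ▸ hstrict p
    have hloc := hf.contDiffAt.to_localInverse (a := p) hs.hasFDerivAt hne
    refine hloc.congr_of_eventuallyEq ?_
    exact hs.localInverse_unique (Filter.mem_of_superset (hUopen.mem_nhds hp) hg)
  have hK : IsClosed (f '' C) := (hC.image hf.continuous).isClosed
  obtain ⟨χ, hχ0, hχ1, -⟩ := exists_contMDiffMap_zero_one_nhds_of_isClosed (n := (⊤ : ℕ∞))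
    (modelWithCornersSelf ℝ E) hVopen.isClosed_compl hK
    (disjoint_compl_left_iff_subset.2 (image_mono hCU))
  have hχ : ContDiff ℝ (⊤ : ℕ∞) χ := χ.contMDiff.contDiff
  refine ⟨fun q => χ q • g q, contDiff_iff_contDiffAt.2 fun q => ?_, fun p hp => ?_⟩
  · by_cases hq : q ∈ f '' U
    · exact hχ.contDiffAt.smul (hgsmooth q hq)
    · refine (contDiffAt_const (c := (0 : E))).congr_of_eventuallyEq ?_
      filter_upwards [hχ0.filter_mono (nhds_le_nhdsSet hq)] with x hx
      simp [hx]
  · have h1 : χ (f p) = 1 := hχ1.self_of_nhdsSet _ (mem_image_of_mem f hp)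
    simp [h1, hg (hCU hp)]

theorem II_uniqueDiffOn : UniqueDiffOn ℝ II := uniqueDiffOn_Icc one_pos

theorem cube_uniqueDiffOn : UniqueDiffOn ℝ cube :=
  II_uniqueDiffOn.prod (II_uniqueDiffOn.prod II_uniqueDiffOn)

theorem isCompact_cube : IsCompact cube :=
  isCompact_Icc.prod (isCompact_Icc.prod isCompact_Icc)

theorem zero_mem_II : (0 : ℝ) ∈ II := ⟨le_rfl, zero_le_one⟩

theorem one_mem_II : (1 : ℝ) ∈ II := ⟨zero_le_one, le_rfl⟩

/-- An increasing self-bijection of `[0,1]` fixes the endpoints. -/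
theorem endpoints_of_strictMonoOn_image {f : ℝ → ℝ} (hf : StrictMonoOn f II)
    (him : f '' II = II) : f 0 = 0 ∧ f 1 = 1 := by
  have hmaps : ∀ t ∈ II, f t ∈ II := fun t ht => him ▸ mem_image_of_mem f ht
  obtain ⟨a, ha, ha0⟩ : (0 : ℝ) ∈ f '' II := him.symm ▸ zero_mem_II
  obtain ⟨b, hb, hb1⟩ : (1 : ℝ) ∈ f '' II := him.symm ▸ one_mem_II
  have h0 := hf.monotoneOn zero_mem_II ha ha.1
  have h1 := hf.monotoneOn hb one_mem_II hb.2
  exact ⟨le_antisymm (by linarith) (hmaps 0 zero_mem_II).1,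
    le_antisymm (hmaps 1 one_mem_II).2 (by linarith)⟩

/-- A continuous increasing function on `[0,1]` fixing the endpoints is onto `[0,1]`. -/
theorem image_II_eq {f : ℝ → ℝ} (hf : StrictMonoOn f II) (hc : ContinuousOn f II)
    (h0 : f 0 = 0) (h1 : f 1 = 1) : f '' II = II := by
  apply Subset.antisymm
  · rintro _ ⟨t, ht, rfl⟩
    exact ⟨h0 ▸ hf.monotoneOn zero_mem_II ht ht.1, h1 ▸ hf.monotoneOn ht one_mem_II ht.2⟩
  · have := intermediate_value_Icc zero_le_one hc
    rwa [h0, h1] at this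

/-- Convex combinations of increasing self-homeomorphisms of `[0,1]` are again such. -/
theorem convexComb_strictMonoOn_image {f g : ℝ → ℝ} {a : ℝ} (ha : a ∈ II)
    (hf : StrictMonoOn f II ∧ f '' II = II) (hg : StrictMonoOn g II ∧ g '' II = II)
    (hfc : Continuous f) (hgc : Continuous g) :
    StrictMonoOn (fun t => (1 - a) * f t + a * g t) II ∧
      (fun t => (1 - a) * f t + a * g t) '' II = II := by
  have hmono : StrictMonoOn (fun t => (1 - a) * f t + a * g t) II := by
    intro t ht u hu htu
    have h1 := hf.1 ht hu htu
    have h2 := hg.1 ht hu htu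
    rcases ha.1.eq_or_lt with h | h
    · simpa [← h] using h1
    · have := mul_lt_mul_of_pos_left h2 h
      have := mul_le_mul_of_nonneg_left h1.le (sub_nonneg.2 ha.2)
      dsimp only
      linarith
  obtain ⟨hf0, hf1⟩ := endpoints_of_strictMonoOn_image hf.1 hf.2
  obtain ⟨hg0, hg1⟩ := endpoints_of_strictMonoOn_image hg.1 hg.2
  exact ⟨hmono, image_II_eq hmono (by fun_prop) (by simp [hf0, hg0]) (by simp [hf1, hg1])⟩

/-- A triangular monotone family consists of bijections of the cube. -/
theorem TriangularMonotone.bijOn {H : Pt3 → ℝ → Pt3} (h : TriangularMonotone H) {s : ℝ}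
    (hs : s ∈ II) : BijOn (fun p => H p s) cube cube := by
  refine ⟨?_, ?_, ?_⟩
  · rintro ⟨x, y, z⟩ ⟨hx, hy, hz⟩
    exact ⟨(h.xMono s hs y z).2 ▸ mem_image_of_mem _ hx,
      (h.yMono s hs x z).2 ▸ mem_image_of_mem _ hy,
      (h.zMono s hs x y).2 ▸ mem_image_of_mem _ hz⟩
  · rintro ⟨x, y, z⟩ ⟨hx, hy, hz⟩ ⟨x', y', z'⟩ ⟨hx', hy', hz'⟩ heq
    dsimp only at hx hy hz hx' hy' hz' heq
    obtain rfl : z = z' := (h.zMono s hs x y).1.injOn hz hz'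
      ((congrArg z3 heq).trans (h.zOnly s hs _ _ rfl))
    obtain rfl : y = y' := (h.yMono s hs x z).1.injOn hy hy'
      ((congrArg y3 heq).trans (h.yOnly s hs _ _ rfl rfl))
    obtain rfl : x = x' := (h.xMono s hs y z).1.injOn hx hx' (congrArg x3 heq)
    rfl
  · rintro ⟨x, y, z⟩ ⟨hx, hy, hz⟩
    obtain ⟨c, hc, hcz⟩ : z ∈ (fun z => z3 (H (0, 0, z) s)) '' II := by
      rwa [(h.zMono s hs 0 0).2]
    obtain ⟨b, hb, hby⟩ : y ∈ (fun y => y3 (H (0, y, c) s)) '' II := by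
      rwa [(h.yMono s hs 0 c).2]
    obtain ⟨a, ha, hax⟩ : x ∈ (fun x => x3 (H (x, b, c) s)) '' II := by
      rwa [(h.xMono s hs b c).2]
    exact ⟨(a, b, c), ⟨ha, hb, hc⟩, Prod.ext hax (Prod.ext
      ((h.yOnly s hs (a, b, c) (0, b, c) rfl rfl).trans hby)
      ((h.zOnly s hs (a, b, c) (0, 0, c) rfl).trans hcz))⟩

/-- An endomorphism of `ℝ³` which is upper triangular with positive diagonal entries. -/
structure PosTriangular (L : Pt3 →L[ℝ] Pt3) : Prop where
  xx : 0 < x3 (L (1, 0, 0))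
  yx : y3 (L (1, 0, 0)) = 0
  zx : z3 (L (1, 0, 0)) = 0
  yy : 0 < y3 (L (0, 1, 0))
  zy : z3 (L (0, 1, 0)) = 0
  zz : 0 < z3 (L (0, 0, 1))

theorem apply_eq_basis_comb (L : Pt3 →L[ℝ] Pt3) (a b c : ℝ) :
    L (a, b, c) = a • L (1, 0, 0) + b • L (0, 1, 0) + c • L (0, 0, 1) := by
  simp only [← map_smul, ← map_add]
  simp

theorem PosTriangular.injective {L : Pt3 →L[ℝ] Pt3} (h : PosTriangular L) :
    Function.Injective L := by
  rw [injective_iff_map_eq_zero]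
  rintro ⟨a, b, c⟩ hv
  rw [apply_eq_basis_comb] at hv
  obtain ⟨h1, h2, h3, h4, h5, h6⟩ := h
  simp only [x3, y3, z3] at h1 h2 h3 h4 h5 h6
  have hz := congrArg (fun p : Pt3 => p.2.2) hv
  have hy := congrArg (fun p : Pt3 => p.2.1) hv
  have hx := congrArg (fun p : Pt3 => p.1) hv
  simp [h2, h3, h5, h6.ne'] at hx hy hz
  simp [hz, h4.ne'] at hy
  simp [hy, hz, h1.ne'] at hx
  simp [hx, hy, hz]

theorem hasDerivAt_coords {γ : ℝ → Pt3} {v : Pt3} {t : ℝ} (h : HasDerivAt γ v t) :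
    HasDerivAt (fun u => x3 (γ u)) (x3 v) t ∧ HasDerivAt (fun u => y3 (γ u)) (y3 v) t ∧
      HasDerivAt (fun u => z3 (γ u)) (z3 v) t :=
  ⟨(ContinuousLinearMap.fst ℝ ℝ (ℝ × ℝ)).hasFDerivAt.comp_hasDerivAt t h,
    ((ContinuousLinearMap.fst ℝ ℝ ℝ).comp
      (ContinuousLinearMap.snd ℝ ℝ (ℝ × ℝ))).hasFDerivAt.comp_hasDerivAt t h,
    ((ContinuousLinearMap.snd ℝ ℝ ℝ).comp
      (ContinuousLinearMap.snd ℝ ℝ (ℝ × ℝ))).hasFDerivAt.comp_hasDerivAt t h⟩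

/-- A function which is increasing on `[0,1]` has nonnegative derivative there. -/
theorem nonneg_of_hasDerivAt_of_strictMonoOn {f : ℝ → ℝ} {f' t : ℝ} (hf : StrictMonoOn f II)
    (hd : HasDerivAt f f' t) (ht : t ∈ II) : 0 ≤ f' := by
  rw [← hd.hasDerivWithinAt.derivWithin (II_uniqueDiffOn t ht)]
  exact hf.monotoneOn.derivWithin_nonneg

/-- The derivatives of a triangular monotone ambient isotopy are triangular with positive
diagonal. -/
theorem posTriangular_fderiv {H : Pt3 → ℝ → Pt3} (hH : CubeIsotopy H)
    (h : TriangularMonotone H) {s : ℝ} (hs : s ∈ II) {p : Pt3} (hp : p ∈ cube) :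
    PosTriangular (fderiv ℝ (fun p => H p s) p) := by
  have hsm : ContDiff ℝ (⊤ : ℕ∞) (fun p => H p s) :=
    hH.smooth.comp (contDiff_id.prodMk contDiff_const)
  have hd : HasFDerivAt (fun p => H p s) (fderiv ℝ (fun p => H p s) p) p :=
    (hsm.differentiable (by simp) p).hasFDerivAt
  set L := fderiv ℝ (fun p => H p s) p
  have hinj : Function.Injective L := by
    obtain ⟨G, hG, hinv⟩ := hH.diffeo s hs
    have hGd := (hG.differentiable (by simp) (H p s)).hasFDerivAt
    have h1 : HasFDerivWithinAt (fun q => G (H q s)) ((fderiv ℝ G (H p s)).comp L) cube p :=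
      (hGd.comp p hd).hasFDerivWithinAt
    have h2 : HasFDerivWithinAt (fun q => G (H q s)) (ContinuousLinearMap.id ℝ Pt3) cube p :=
      (hasFDerivWithinAt_id p cube).congr (fun q hq => hinv.1 hq) (hinv.1 hp)
    have heq := (cube_uniqueDiffOn p hp).eq h1 h2
    exact Function.LeftInverse.injective (g := fderiv ℝ G (H p s))
      fun v => DFunLike.congr_fun heq v
  obtain ⟨x, y, z⟩ := p
  obtain ⟨hx, hy, hz⟩ := hp
  have hdx : HasDerivAt (fun t => H (t, y, z) s) (L (1, 0, 0)) x :=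
    HasFDerivAt.comp_hasDerivAt (l := fun p => H p s) (l' := L) x hd ((hasDerivAt_id x).prodMk (hasDerivAt_const x (y, z)))
  have hdy : HasDerivAt (fun t => H (x, t, z) s) (L (0, 1, 0)) y :=
    HasFDerivAt.comp_hasDerivAt (l := fun p => H p s) (l' := L) y hd
      ((hasDerivAt_const y x).prodMk ((hasDerivAt_id y).prodMk (hasDerivAt_const y z)))
  have hdz : HasDerivAt (fun t => H (x, y, t) s) (L (0, 0, 1)) z :=
    HasFDerivAt.comp_hasDerivAt (l := fun p => H p s) (l' := L) z hd
      ((hasDerivAt_const z x).prodMk ((hasDerivAt_const z y).prodMk (hasDerivAt_id z)))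
  have hyx : y3 (L (1, 0, 0)) = 0 :=
    (hasDerivAt_coords hdx).2.1.unique ((hasDerivAt_const x (y3 (H (x, y, z) s))).congr_of_eventuallyEq
      (.of_forall fun t => h.yOnly s hs (t, y, z) (x, y, z) rfl rfl))
  have hzx : z3 (L (1, 0, 0)) = 0 :=
    (hasDerivAt_coords hdx).2.2.unique ((hasDerivAt_const x (z3 (H (x, y, z) s))).congr_of_eventuallyEq
      (.of_forall fun t => h.zOnly s hs (t, y, z) (x, y, z) rfl))
  have hzy : z3 (L (0, 1, 0)) = 0 :=
    (hasDerivAt_coords hdy).2.2.unique ((hasDerivAt_const y (z3 (H (x, y, z) s))).congr_of_eventuallyEq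
      (.of_forall fun t => h.zOnly s hs (x, t, z) (x, y, z) rfl))
  have hxx : 0 ≤ x3 (L (1, 0, 0)) :=
    nonneg_of_hasDerivAt_of_strictMonoOn (h.xMono s hs y z).1
      (hasDerivAt_coords hdx).1 hx
  have hyy : 0 ≤ y3 (L (0, 1, 0)) :=
    nonneg_of_hasDerivAt_of_strictMonoOn (h.yMono s hs x z).1
      (hasDerivAt_coords hdy).2.1 hy
  have hzz : 0 ≤ z3 (L (0, 0, 1)) :=
    nonneg_of_hasDerivAt_of_strictMonoOn (h.zMono s hs x y).1
      (hasDerivAt_coords hdz).2.2 hz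
  have hker : ∀ a b c : ℝ, a • L (1, 0, 0) + b • L (0, 1, 0) + c • L (0, 0, 1) = 0 →
      a = 0 ∧ b = 0 ∧ c = 0 := fun a b c h0 => by
    rw [← apply_eq_basis_comb, map_eq_zero_iff L hinj] at h0
    simpa using h0
  simp only [x3, y3, z3] at *
  have hxx' : (L (1, 0, 0)).1 ≠ 0 := fun h0 => by
    have := hker 1 0 0 (by ext <;> simp [h0, hyx, hzx])
    simp at this
  have hyy' : (L (0, 1, 0)).2.1 ≠ 0 := fun h0 => by
    have := hker (-(L (0, 1, 0)).1 / (L (1, 0, 0)).1) 1 0 (by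
      ext <;> simp [h0, hyx, hzx, hzy, hxx'])
    simp at this
  have hzz' : (L (0, 0, 1)).2.2 ≠ 0 := fun h0 => by
    have := hker (-((L (0, 0, 1)).1 - (L (0, 0, 1)).2.1 / (L (0, 1, 0)).2.1 * (L (0, 1, 0)).1)
      / (L (1, 0, 0)).1) (-(L (0, 0, 1)).2.1 / (L (0, 1, 0)).2.1) 1 (by
      ext <;> simp [h0, hyx, hzx, hzy, hxx', hyy']
      ring)
    simp at this
  exact ⟨hxx.lt_of_ne' hxx', hyx, hzx, hyy.lt_of_ne' hyy', hzy, hzz.lt_of_ne' hzz'⟩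

theorem convexComb_pos {a u v : ℝ} (ha : a ∈ II) (hu : 0 < u) (hv : 0 < v) :
    0 < (1 - a) * u + a * v :=
  (convex_Ioi (0 : ℝ)) hu hv (sub_nonneg.2 ha.2) ha.1 (sub_add_cancel 1 a)

/-- A convex combination of triangular maps with positive diagonal, plus a rank one correction
along `z` with horizontal value, is triangular with positive diagonal. -/
theorem PosTriangular.convexComb_add {L M N : Pt3 →L[ℝ] Pt3} (hL : PosTriangular L)
    (hM : PosTriangular M) {a : ℝ} (ha : a ∈ II) (hx : N (1, 0, 0) = 0) (hy : N (0, 1, 0) = 0)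
    (hz : z3 (N (0, 0, 1)) = 0) : PosTriangular ((1 - a) • L + a • M + N) := by
  obtain ⟨h1, h2, h3, h4, h5, h6⟩ := hL
  obtain ⟨k1, k2, k3, k4, k5, k6⟩ := hM
  simp only [x3, y3, z3] at *
  constructor <;> simp [x3, y3, z3, *, convexComb_pos]

/-- **The gluing lemma for equivalence isotopies** (used to prove that
composition of 1-morphisms in `𝒯` is well defined): gluing an ambient isotopy
`H` of the cube with a product structure in the `z` direction for
`z ∈ [1/4,1]` to an ambient isotopy `J` with a product structure for
`z ∈ [0,3/4]`, by the convex combination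
`K(x,y,z,s) = (1 − φ(z)) H(x,y,z,s) + φ(z) J(x,y,z,s)` along a smooth monotone
cutoff `φ` which is `0` on `[0, 1/4+ε]` and `1` on `[3/4−ε, 1]`, yields an
ambient isotopy `K` of the cube, inheriting the triangular monotonicity
structure of `H` and `J`. -/
theorem gluing_of_equivalence_isotopies
    (H J : Pt3 → ℝ → Pt3) (φ : ℝ → ℝ) (ε : ℝ) (hε : 0 < ε)
    (hH : CubeIsotopy H) (hJ : CubeIsotopy J)
    (hHtri : TriangularMonotone H) (hJtri : TriangularMonotone J)
    (hHprod : IsotopyProductZOn H (1/4) 1)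
    (hJprod : IsotopyProductZOn J 0 (3/4))
    (hφsmooth : ContDiff ℝ (⊤ : ℕ∞) φ)
    (hφmono : MonotoneOn φ II) (hφrange : MapsTo φ II II)
    (hφ0 : ∀ z ≤ 1/4 + ε, φ z = 0) (hφ1 : ∀ z, 3/4 - ε ≤ z → φ z = 1) :
    CubeIsotopy (fun p s => (1 - φ (z3 p)) • H p s + φ (z3 p) • J p s) ∧
    TriangularMonotone (fun p s => (1 - φ (z3 p)) • H p s + φ (z3 p) • J p s) := by
  have hε' : ε < 1 / 4 := by
    by_contra! hcon
    have h0 := hφ0 (1 / 2) (by linarith)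
    have h1 := hφ1 (1 / 2) (by linarith)
    linarith
  have hφmem : ∀ z, φ z ∈ II := fun z => by
    rcases lt_or_ge z 0 with h | h
    · rw [hφ0 z (by linarith)]; exact zero_mem_II
    rcases lt_or_ge 1 z with h' | h'
    · rw [hφ1 z (by linarith)]; exact one_mem_II
    exact hφrange ⟨h, h'⟩
  have hHs : ∀ s, ContDiff ℝ (⊤ : ℕ∞) (fun p => H p s) := fun s =>
    hH.smooth.comp (contDiff_id.prodMk contDiff_const)
  have hJs : ∀ s, ContDiff ℝ (⊤ : ℕ∞) (fun p => J p s) := fun s =>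
    hJ.smooth.comp (contDiff_id.prodMk contDiff_const)
  have hz3 : ContDiff ℝ (⊤ : ℕ∞) z3 := contDiff_snd.comp contDiff_snd
  have htri : TriangularMonotone
      (fun p s => (1 - φ (z3 p)) • H p s + φ (z3 p) • J p s) := by
    refine ⟨fun s hs p q hpq => ?_, fun s hs x y => ?_, fun s hs p q hy hz => ?_,
      fun s hs x z => ?_, fun s hs y z => ?_⟩
    · have h1 := hHtri.zOnly s hs p q hpq
      have h2 := hJtri.zOnly s hs p q hpq
      simp only [z3] at *
      simp [h1, h2, hpq]
    · have hlow : ∀ z ∈ Icc (0 : ℝ) (3 / 4),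
          z3 ((1 - φ z) • H (x, y, z) s + φ z • J (x, y, z) s) = z3 (H (x, y, z) s) := by
        intro z hz
        rcases le_total z (1 / 4) with h | h
        · simp [hφ0 z (by linarith)]
        · have h1 := (hHprod s hs x y z ⟨h, by linarith [hz.2]⟩ z ⟨h, by linarith [hz.2]⟩).2.2
          have h2 := (hJprod s hs x y z hz z hz).2.2
          simp only [z3] at *
          simp only [Prod.snd_add, Prod.smul_snd, h1, h2, smul_eq_mul]
          ring
      have hhigh : ∀ z ∈ Icc (1 / 4 : ℝ) 1,
          z3 ((1 - φ z) • H (x, y, z) s + φ z • J (x, y, z) s) = z3 (J (x, y, z) s) := by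
        intro z hz
        rcases le_total (3 / 4) z with h | h
        · simp [hφ1 z (by linarith)]
        · have h1 := (hHprod s hs x y z hz z hz).2.2
          have hz' : z ∈ Icc (0 : ℝ) (3 / 4) := ⟨by linarith [hz.1], h⟩
          have h2 := (hJprod s hs x y z hz' z hz').2.2
          simp only [z3] at *
          simp only [Prod.snd_add, Prod.smul_snd, h1, h2, smul_eq_mul]
          ring
      have hunion : II = Icc 0 (1 / 2) ∪ Icc (1 / 2) 1 :=
        (Icc_union_Icc_eq_Icc (by norm_num) (by norm_num)).symm
      have hmono : StrictMonoOn
          (fun z => z3 ((1 - φ z) • H (x, y, z) s + φ z • J (x, y, z) s)) II := by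
        rw [hunion]
        refine StrictMonoOn.union (c := 1 / 2) ?_ ?_ (isGreatest_Icc (by norm_num))
          (isLeast_Icc (by norm_num))
        · refine ((hHtri.zMono s hs x y).1.mono ?_).congr ?_
          · exact Icc_subset_Icc_right (by norm_num)
          · exact fun z hz => (hlow z ⟨hz.1, by linarith [hz.2]⟩).symm
        · refine ((hJtri.zMono s hs x y).1.mono ?_).congr ?_
          · exact Icc_subset_Icc_left (by norm_num)
          · exact fun z hz => (hhigh z ⟨by linarith [hz.1], hz.2⟩).symm
      refine ⟨hmono, image_II_eq hmono ?_ ?_ ?_⟩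
      · have := hz3.continuous
        have := (hHs s).continuous
        have := (hJs s).continuous
        have := hφsmooth.continuous
        fun_prop
      · exact (hlow 0 (by norm_num)).trans (endpoints_of_strictMonoOn_image
          (hHtri.zMono s hs x y).1 (hHtri.zMono s hs x y).2).1
      · exact (hhigh 1 (by norm_num)).trans (endpoints_of_strictMonoOn_image
          (hJtri.zMono s hs x y).1 (hJtri.zMono s hs x y).2).2
    · have h1 := hHtri.yOnly s hs p q hy hz
      have h2 := hJtri.yOnly s hs p q hy hz
      simp only [y3, z3] at *
      simp [h1, h2, hz]
    · have hHc := (hHs s).continuous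
      have hJc := (hJs s).continuous
      exact convexComb_strictMonoOn_image (hφmem z) (hHtri.yMono s hs x z)
        (hJtri.yMono s hs x z) (by fun_prop)
        (by fun_prop)
    · have hHc := (hHs s).continuous
      have hJc := (hJs s).continuous
      exact convexComb_strictMonoOn_image (hφmem z) (hHtri.xMono s hs y z)
        (hJtri.xMono s hs y z) (by fun_prop)
        (by fun_prop)
  have hsmooth : ContDiff ℝ (⊤ : ℕ∞)
      fun q : Pt3 × ℝ => (1 - φ (z3 q.1)) • H q.1 q.2 + φ (z3 q.1) • J q.1 q.2 := by
    have hφz : ContDiff ℝ (⊤ : ℕ∞) fun q : Pt3 × ℝ => φ (z3 q.1) :=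
      hφsmooth.comp (hz3.comp contDiff_fst)
    exact ((contDiff_const.sub hφz).smul hH.smooth).add (hφz.smul hJ.smooth)
  refine ⟨⟨hsmooth, fun s hs => (htri.bijOn hs).mapsTo, fun s hs => ?_⟩, htri⟩
  have hbij := htri.bijOn hs
  obtain ⟨G, hG, hleft⟩ := exists_contDiff_leftInvOn
    (hsmooth.comp (contDiff_id.prodMk (contDiff_const (c := s)))) isCompact_cube hbij.injOn
    (fun p hp => by
      have hdH := ((hHs s).differentiable (by simp) p).hasFDerivAt
      have hdJ := ((hJs s).differentiable (by simp) p).hasFDerivAt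
      have hdz : HasFDerivAt z3
          ((ContinuousLinearMap.snd ℝ ℝ ℝ).comp (ContinuousLinearMap.snd ℝ ℝ (ℝ × ℝ))) p :=
        hasFDerivAt_snd.comp p hasFDerivAt_snd
      have hdφ := (hφsmooth.differentiable (by simp) (z3 p)).hasDerivAt.comp_hasFDerivAt p hdz
      have hdK := ((hdφ.const_sub 1).smul hdH).add (hdφ.smul hdJ)
      have hcorr : deriv φ (z3 p) * (z3 (J p s) - z3 (H p s)) = 0 := by
        obtain ⟨x, y, z⟩ := p
        obtain ⟨-, -, hz⟩ := hp
        change deriv φ z * _ = 0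
        rcases lt_or_ge z (1 / 4) with h | h
        · have : φ =ᶠ[nhds z] fun _ => 0 := by
            filter_upwards [Iio_mem_nhds h] with t ht
            exact hφ0 t (by linarith [show t < 1 / 4 from ht])
          simp [this.deriv_eq]
        rcases lt_or_ge (3 / 4) z with h' | h'
        · have : φ =ᶠ[nhds z] fun _ => 1 := by
            filter_upwards [Ioi_mem_nhds h'] with t ht
            exact hφ1 t (by linarith [show 3 / 4 < t from ht])
          simp [this.deriv_eq]
        · have hz1 : z ∈ Icc (1 / 4 : ℝ) 1 := ⟨h, hz.2⟩
          have hz2 : z ∈ Icc (0 : ℝ) (3 / 4) := ⟨hz.1, h'⟩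
          rw [(hHprod s hs x y z hz1 z hz1).2.2, (hJprod s hs x y z hz2 z hz2).2.2]
          simp
      have hpos := (posTriangular_fderiv hH hHtri hs hp).convexComb_add
        (posTriangular_fderiv hJ hJtri hs hp) (hφmem (z3 p))
        (N := (deriv φ (z3 p) • (ContinuousLinearMap.snd ℝ ℝ ℝ).comp
          (ContinuousLinearMap.snd ℝ ℝ (ℝ × ℝ))).smulRight (J p s - H p s))
        (by simp) (by simp) (by simpa [z3] using hcorr)
      convert hpos.injective using 2
      refine (HasFDerivAt.fderiv hdK).trans ?_
      refine ContinuousLinearMap.ext fun v => ?_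
      simp only [add_apply, smul_apply,
        ContinuousLinearMap.smulRight_apply, neg_apply, Function.comp_apply]
      module)
  exact ⟨G, hG, hleft, hleft.rightInvOn_image.mono hbij.image_eq.ge⟩

end HDA4
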